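/- Let f : ℝ^d → ℝ be convex and L-smooth with minimizer x* and minimal value f*. Consider Nesterov-accelerated SGD iterates x_{k+1} = y_k − η g_k, z_{k+1} = z_k − γ_k η g_k, y_{k+1} = α_{k+1} z_{k+1} + (1 − α_{k+1}) x_{k+1}, starting from x_0 = y_0 = z_0, where each stochastic gradient g_k satisfies, conditionally on the history, E[g_k] = ∇f(y_k) (unbiasedness) and E[‖g_k‖²] ≤ ρ ‖∇f(y_k)‖² + σ², with parameters ρ̃ = max{1, ρ}, η = 1/(ρ̃ L), γ_0 = 0, γ_k = (ρ̃^{−1} + √(ρ̃^{−2} + 4γ_{k−1}²))/2, a_{k+1} = γ_k √(η ρ̃), α_k = γ_k η/(γ_k η + a_k²). Let R = ‖z_0 − x*‖. Then there exists an absolute constant C such that for every N ≥ 1: E[f(x_N)] − f* ≤ C (ρ̃² L R²/N² + N σ²/(L ρ̃²)). -/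

import Mathlib

open MeasureTheory
open scoped RealInnerProductSpace

section Smooth

variable {E : Type*} [NormedAddCommGroup E] [InnerProductSpace ℝ E] [CompleteSpace E]
  {f : E → ℝ} {L : ℝ}

/-- First-order characterization of convexity: the tangent plane lies below the graph. -/
theorem ConvexOn.add_inner_gradient_le (hf : ConvexOn ℝ Set.univ f) (hd : Differentiable ℝ f)
    (u v : E) : f u + ⟪gradient f u, v - u⟫ ≤ f v := by
  have hline : ConvexOn ℝ Set.univ fun t : ℝ => f (AffineMap.lineMap u v t) := by
    simpa [Function.comp_def] using hf.comp_affineMap (AffineMap.lineMap u v)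
  have hderiv : HasDerivAt (fun t : ℝ => f (AffineMap.lineMap u v t)) ⟪gradient f u, v - u⟫ 0 := by
    rw [inner_gradient_left]
    have h : HasFDerivAt f (fderiv ℝ f u) (AffineMap.lineMap u v (0 : ℝ)) := by
      simpa using (hd u).hasFDerivAt
    exact h.comp_hasDerivAt (0 : ℝ) AffineMap.hasDerivAt_lineMap
  have h := hline.le_slope_of_hasDerivAt (Set.mem_univ 0) (Set.mem_univ 1) one_pos hderiv
  simp only [slope_def_field, AffineMap.lineMap_apply_one, AffineMap.lineMap_apply_zero, sub_zero,
    div_one] at h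
  linarith

/-- A smooth function bounded below by `c` has gradient controlled by its excess over `c`. -/
theorem norm_gradient_sq_le_of_smooth (hL : 0 < L)
    (hs : ∀ u v : E, f v ≤ f u + ⟪gradient f u, v - u⟫ + L / 2 * ‖v - u‖ ^ 2)
    {c : ℝ} (hc : ∀ u, c ≤ f u) (u : E) : ‖gradient f u‖ ^ 2 ≤ 2 * L * (f u - c) := by
  have h := (hc _).trans (hs u (u - L⁻¹ • gradient f u))
  have e : u - L⁻¹ • gradient f u - u = -(L⁻¹ • gradient f u) := by abel
  rw [e, inner_neg_right, inner_smul_right, real_inner_self_eq_norm_sq, norm_neg, norm_smul,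
    Real.norm_of_nonneg (inv_nonneg.2 hL.le)] at h
  have h2 := mul_le_mul_of_nonneg_left h (mul_pos two_pos hL).le
  have e2 : 2 * L * (f u + -(L⁻¹ * ‖gradient f u‖ ^ 2) + L / 2 * (L⁻¹ * ‖gradient f u‖) ^ 2)
      = 2 * L * f u - ‖gradient f u‖ ^ 2 := by
    field_simp
    ring
  linarith

/-- Quadratic growth bound of a smooth function around a minimizer. -/
theorem le_add_norm_sub_sq_of_smooth (hL : 0 < L)
    (hs : ∀ u v : E, f v ≤ f u + ⟪gradient f u, v - u⟫ + L / 2 * ‖v - u‖ ^ 2)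
    {p : E} (hp : ∀ u, f p ≤ f u) (u : E) : f u ≤ f p + L / 2 * ‖u - p‖ ^ 2 := by
  have h0 := norm_gradient_sq_le_of_smooth hL hs hp p
  have hg : gradient f p = 0 := by
    rw [sub_self, mul_zero] at h0
    exact norm_eq_zero.1 (pow_eq_zero_iff two_ne_zero |>.1 (le_antisymm h0 (sq_nonneg _)))
  simpa [hg] using hs p u

end Smooth

section Stochastic

variable {E : Type*} [NormedAddCommGroup E] {Ω : Type*} {m mΩ : MeasurableSpace Ω} {μ : Measure Ω}

theorem integral_norm_sq_le_of_growth [IsProbabilityMeasure μ] (hm : m ≤ mΩ) {G D : Ω → E} {ρ σ2 : ℝ}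
    (hD : MemLp D 2 μ)
    (hgrow : ∀ᵐ ω ∂μ, (μ[(fun ω' => ‖G ω'‖ ^ 2) | m]) ω ≤ ρ * ‖D ω‖ ^ 2 + σ2) :
    ∫ ω, ‖G ω‖ ^ 2 ∂μ ≤ ρ * (∫ ω, ‖D ω‖ ^ 2 ∂μ) + σ2 := by
  have hD2 := (hD.integrable_norm_pow two_ne_zero).const_mul ρ
  rw [← integral_condExp hm]
  refine (integral_mono_ae integrable_condExp (hD2.add (integrable_const σ2)) hgrow).trans_eq ?_
  simp only [Pi.add_apply]
  rw [integral_add hD2 (integrable_const σ2), integral_const_mul]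
  simp

variable [InnerProductSpace ℝ E]

theorem MeasureTheory.MemLp.integrable_real_inner {U V : Ω → E} (hU : MemLp U 2 μ)
    (hV : MemLp V 2 μ) : Integrable (fun ω => ⟪U ω, V ω⟫) μ := by
  refine ((hU.integrable_norm_pow two_ne_zero).add
    (hV.integrable_norm_pow two_ne_zero)).mono' (hU.1.inner hV.1) (.of_forall fun ω => ?_)
  have h := norm_inner_le_norm (𝕜 := ℝ) (U ω) (V ω)
  simp only [Pi.add_apply]
  nlinarith [sq_nonneg (‖U ω‖ - ‖V ω‖), sq_nonneg ‖U ω‖, sq_nonneg ‖V ω‖]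

variable [CompleteSpace E]

theorem integral_inner_eq_of_condExp [IsFiniteMeasure μ] (hm : m ≤ mΩ) {U G D : Ω → E}
    (hU : AEStronglyMeasurable[m] U μ) (hU2 : MemLp U 2 μ) (hG : MemLp G 2 μ)
    (hD : μ[G | m] =ᵐ[μ] D) : ∫ ω, ⟪U ω, G ω⟫ ∂μ = ∫ ω, ⟪U ω, D ω⟫ ∂μ := by
  have h := condExp_bilin_of_aestronglyMeasurable_left (innerSL ℝ (E := E)) hU
    (hU2.integrable_real_inner hG) (hG.integrable one_le_two)
  rw [← integral_condExp hm]
  refine integral_congr_ae ?_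
  filter_upwards [h, hD] with ω h1 h2
  rw [← h2]
  exact h1

variable [IsProbabilityMeasure μ] {f : E → ℝ} {L : ℝ} {p : E}

theorem integrable_comp_of_smooth (hL : 0 < L) (hd : Differentiable ℝ f)
    (hs : ∀ u v : E, f v ≤ f u + ⟪gradient f u, v - u⟫ + L / 2 * ‖v - u‖ ^ 2)
    (hp : ∀ u, f p ≤ f u) {W : Ω → E} (hW : MemLp W 2 μ) : Integrable (fun ω => f (W ω)) μ := by
  have h2 := (hW.sub (memLp_const p)).integrable_norm_pow two_ne_zero
  refine ((integrable_const |f p|).add (h2.const_mul (L / 2))).mono'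
    (hd.continuous.comp_aestronglyMeasurable hW.1) (.of_forall fun ω => ?_)
  have h3 := le_add_norm_sub_sq_of_smooth hL hs hp (W ω)
  have h4 := hp (W ω)
  have h5 : 0 ≤ L / 2 * ‖W ω - p‖ ^ 2 := by positivity
  simp only [Pi.add_apply, Pi.sub_apply, Real.norm_eq_abs]
  exact abs_le.2 ⟨by linarith [neg_abs_le (f p)], by linarith [le_abs_self (f p)]⟩

theorem memLp_gradient_comp_of_smooth (hL : 0 < L) (hd : Differentiable ℝ f)
    (hs : ∀ u v : E, f v ≤ f u + ⟪gradient f u, v - u⟫ + L / 2 * ‖v - u‖ ^ 2)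
    (hp : ∀ u, f p ≤ f u) {W : Ω → E} (hW : MemLp W 2 μ)
    (hmeas : AEStronglyMeasurable (fun ω => gradient f (W ω)) μ) :
    MemLp (fun ω => gradient f (W ω)) 2 μ := by
  rw [memLp_two_iff_integrable_sq_norm hmeas]
  refine (((integrable_comp_of_smooth hL hd hs hp hW).sub (integrable_const (f p))).const_mul
    (2 * L)).mono' (hmeas.norm.pow 2) (.of_forall fun ω => ?_)
  rw [Real.norm_of_nonneg (sq_nonneg _)]
  exact norm_gradient_sq_le_of_smooth hL hs hp (W ω)

variable {Y G : Ω → E} {ρ σ2 : ℝ}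

theorem memLp_gradient_of_condExp (hm : m ≤ mΩ) (hL : 0 < L) (hd : Differentiable ℝ f)
    (hs : ∀ u v : E, f v ≤ f u + ⟪gradient f u, v - u⟫ + L / 2 * ‖v - u‖ ^ 2)
    (hp : ∀ u, f p ≤ f u) (hY : MemLp Y 2 μ)
    (hunb : μ[G | m] =ᵐ[μ] fun ω => gradient f (Y ω)) :
    MemLp (fun ω => gradient f (Y ω)) 2 μ :=
  memLp_gradient_comp_of_smooth hL hd hs hp hY
    ((stronglyMeasurable_condExp.mono hm).aestronglyMeasurable.congr hunb)

/-- Expected decrease of a smooth function along a stochastic gradient step. -/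
theorem integral_gradient_step_le (hm : m ≤ mΩ) (hL : 0 < L) (hd : Differentiable ℝ f)
    (hs : ∀ u v : E, f v ≤ f u + ⟪gradient f u, v - u⟫ + L / 2 * ‖v - u‖ ^ 2)
    (hp : ∀ u, f p ≤ f u) (hY : MemLp Y 2 μ) (hG : MemLp G 2 μ)
    (hunb : μ[G | m] =ᵐ[μ] fun ω => gradient f (Y ω))
    (hgrow : ∀ᵐ ω ∂μ, (μ[(fun ω' => ‖G ω'‖ ^ 2) | m]) ω ≤ ρ * ‖gradient f (Y ω)‖ ^ 2 + σ2)
    {η : ℝ} (hη : 0 ≤ η) (hηL : L * η * ρ ≤ 1) :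
    ∫ ω, f (Y ω - η • G ω) ∂μ ≤ ∫ ω, f (Y ω) ∂μ - η / 2 * ∫ ω, ‖gradient f (Y ω)‖ ^ 2 ∂μ
      + L / 2 * η ^ 2 * σ2 := by
  have hD := memLp_gradient_of_condExp hm hL hd hs hp hY hunb
  have hS := integral_norm_sq_le_of_growth hm hD hgrow
  have hI : ∫ ω, ⟪gradient f (Y ω), G ω⟫ ∂μ = ∫ ω, ‖gradient f (Y ω)‖ ^ 2 ∂μ := by
    rw [integral_inner_eq_of_condExp hm
      (stronglyMeasurable_condExp.aestronglyMeasurable.congr hunb) hD hG hunb]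
    simp only [real_inner_self_eq_norm_sq]
  have iF := integrable_comp_of_smooth hL hd hs hp hY
  have iI := (hD.integrable_real_inner hG).const_mul η
  have iFI : Integrable (fun ω => f (Y ω) - η * ⟪gradient f (Y ω), G ω⟫) μ := iF.sub iI
  have iG := (hG.integrable_norm_pow two_ne_zero).const_mul (L / 2 * η ^ 2)
  have hpt : ∫ ω, f (Y ω - η • G ω) ∂μ ≤ ∫ ω, (f (Y ω) - η * ⟪gradient f (Y ω), G ω⟫
      + L / 2 * η ^ 2 * ‖G ω‖ ^ 2) ∂μ := by
    refine integral_mono (integrable_comp_of_smooth hL hd hs hp (hY.sub (hG.const_smul η)))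
      (iFI.add iG) fun ω => ?_
    have h := hs (Y ω) (Y ω - η • G ω)
    have e : Y ω - η • G ω - Y ω = -(η • G ω) := by abel
    rw [e, inner_neg_right, inner_smul_right, norm_neg, norm_smul, Real.norm_of_nonneg hη] at h
    dsimp only
    linarith
  rw [integral_add iFI iG, integral_sub iF iI, integral_const_mul, integral_const_mul,
    hI] at hpt
  have hD0 : 0 ≤ ∫ ω, ‖gradient f (Y ω)‖ ^ 2 ∂μ := integral_nonneg fun ω => sq_nonneg _
  have h1 := mul_le_mul_of_nonneg_left hS (by positivity : 0 ≤ L / 2 * η ^ 2)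
  have h2 := mul_le_mul_of_nonneg_right hηL (by positivity :
    0 ≤ η / 2 * ∫ ω, ‖gradient f (Y ω)‖ ^ 2 ∂μ)
  linarith

/-- Expected squared distance to a point after a stochastic gradient step. -/
theorem integral_norm_sub_sq_step_le (hm : m ≤ mΩ) {Z D : Ω → E}
    (hZm : StronglyMeasurable[m] Z) (hZ : MemLp Z 2 μ) (hG : MemLp G 2 μ) (hD : MemLp D 2 μ)
    (hunb : μ[G | m] =ᵐ[μ] D)
    (hgrow : ∀ᵐ ω ∂μ, (μ[(fun ω' => ‖G ω'‖ ^ 2) | m]) ω ≤ ρ * ‖D ω‖ ^ 2 + σ2) (p : E) (c : ℝ) :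
    ∫ ω, ‖Z ω - c • G ω - p‖ ^ 2 ∂μ ≤ ∫ ω, ‖Z ω - p‖ ^ 2 ∂μ
      - 2 * c * ∫ ω, ⟪Z ω - p, D ω⟫ ∂μ + c ^ 2 * (ρ * (∫ ω, ‖D ω‖ ^ 2 ∂μ) + σ2) := by
  have hS := integral_norm_sq_le_of_growth hm hD hgrow
  have hZp : MemLp (fun ω => Z ω - p) 2 μ := hZ.sub (memLp_const p)
  have hI := integral_inner_eq_of_condExp hm
    (hZm.sub stronglyMeasurable_const).aestronglyMeasurable hZp hG hunb
  have iZ := hZp.integrable_norm_pow two_ne_zero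
  have iI := (hZp.integrable_real_inner hG).const_mul (2 * c)
  have iZI : Integrable (fun ω => ‖Z ω - p‖ ^ 2 - 2 * c * ⟪Z ω - p, G ω⟫) μ := iZ.sub iI
  have iG := (hG.integrable_norm_pow two_ne_zero).const_mul (c ^ 2)
  have hpt : ∀ ω, ‖Z ω - c • G ω - p‖ ^ 2
      = ‖Z ω - p‖ ^ 2 - 2 * c * ⟪Z ω - p, G ω⟫ + c ^ 2 * ‖G ω‖ ^ 2 := by
    intro ω
    rw [sub_right_comm, norm_sub_sq_real, inner_smul_right, norm_smul, mul_pow, Real.norm_eq_abs,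
      sq_abs]
    ring
  simp only [hpt]
  rw [integral_add iZI iG, integral_sub iZ iI, integral_const_mul, integral_const_mul]
  simp only [Pi.sub_apply] at hI
  rw [hI]
  linarith [mul_le_mul_of_nonneg_left hS (sq_nonneg c)]

/-- One-step decrease of the expected Lyapunov function of Nesterov's accelerated method. -/
theorem integral_lyapunov_step_le (hm : m ≤ mΩ) (hL : 0 < L) (hconv : ConvexOn ℝ Set.univ f)
    (hd : Differentiable ℝ f)
    (hs : ∀ u v : E, f v ≤ f u + ⟪gradient f u, v - u⟫ + L / 2 * ‖v - u‖ ^ 2)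
    (hp : ∀ u, f p ≤ f u) {X Z : Ω → E} (hX : MemLp X 2 μ) (hY : MemLp Y 2 μ)
    (hZm : StronglyMeasurable[m] Z) (hZ : MemLp Z 2 μ) (hG : MemLp G 2 μ)
    (hunb : μ[G | m] =ᵐ[μ] fun ω => gradient f (Y ω))
    (hgrow : ∀ᵐ ω ∂μ, (μ[(fun ω' => ‖G ω'‖ ^ 2) | m]) ω ≤ ρ * ‖gradient f (Y ω)‖ ^ 2 + σ2)
    {r η c A : ℝ} (hρr : ρ ≤ r) (hη : 0 ≤ η) (hηL : L * η * r = 1)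
    (hc : 0 ≤ c) (hA : 0 ≤ A) (hrc : r * c ^ 2 = A + c)
    (hcomb : ∀ ω, (A + c) • Y ω = c • Z ω + A • X ω) :
    2 * η * (A + c) * (∫ ω, f (Y ω - η • G ω) ∂μ - f p)
        + ∫ ω, ‖Z ω - (c * η) • G ω - p‖ ^ 2 ∂μ
      ≤ 2 * η * A * (∫ ω, f (X ω) ∂μ - f p) + ∫ ω, ‖Z ω - p‖ ^ 2 ∂μ
        + 2 * c ^ 2 * η ^ 2 * σ2 := by
  have hD := memLp_gradient_of_condExp hm hL hd hs hp hY hunb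
  have hZp : MemLp (fun ω => Z ω - p) 2 μ := hZ.sub (memLp_const p)
  have hD0 : 0 ≤ ∫ ω, ‖gradient f (Y ω)‖ ^ 2 ∂μ := integral_nonneg fun ω => sq_nonneg _
  have h1 := integral_gradient_step_le hm hL hd hs hp hY hG hunb hgrow hη
    ((mul_le_mul_of_nonneg_left hρr (by positivity)).trans_eq hηL)
  have h2 := integral_norm_sub_sq_step_le hm hZm hZ hG hD hunb hgrow p (c * η)
  have iY := (integrable_comp_of_smooth hL hd hs hp hY).const_mul (A + c)
  have iX := (integrable_comp_of_smooth hL hd hs hp hX).const_mul A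
  have iYX : Integrable (fun ω => (A + c) * f (Y ω) - A * f (X ω)) μ := iY.sub iX
  have h3 : (A + c) * (∫ ω, f (Y ω) ∂μ) - A * (∫ ω, f (X ω) ∂μ) - c * f p
      ≤ c * ∫ ω, ⟪Z ω - p, gradient f (Y ω)⟫ ∂μ := by
    have hpt : ∫ ω, ((A + c) * f (Y ω) - A * f (X ω) - c * f p) ∂μ
        ≤ ∫ ω, c * ⟪Z ω - p, gradient f (Y ω)⟫ ∂μ := by
      refine integral_mono (iYX.sub (integrable_const _))
        ((hZp.integrable_real_inner hD).const_mul c) fun ω => ?_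
      have hx := hconv.add_inner_gradient_le hd (Y ω) (X ω)
      have hq := hconv.add_inner_gradient_le hd (Y ω) p
      have e : c • (Z ω - p) = -(A • (X ω - Y ω) + c • (p - Y ω)) := by
        have h := hcomb ω
        rw [← sub_eq_zero] at h ⊢
        rw [← neg_eq_zero, ← h]
        module
      dsimp only
      rw [← real_inner_smul_left, e, inner_neg_left, inner_add_left, real_inner_smul_left,
        real_inner_smul_left, real_inner_comm, real_inner_comm _ (p - Y ω)]
      linarith [mul_le_mul_of_nonneg_left hx hA, mul_le_mul_of_nonneg_left hq hc]
    rw [integral_sub iYX (integrable_const _), integral_sub iY iX] at hpt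
    simpa only [integral_const_mul, integral_const, probReal_univ, one_smul] using hpt
  have h4 := mul_le_mul_of_nonneg_left h1 (by positivity : 0 ≤ 2 * η * (A + c))
  have h5 := mul_le_mul_of_nonneg_left h3 (by positivity : 0 ≤ 2 * η)
  have h6 := mul_le_mul_of_nonneg_right hρr (by positivity :
    0 ≤ c ^ 2 * η ^ 2 * ∫ ω, ‖gradient f (Y ω)‖ ^ 2 ∂μ)
  have h7 : L * η * (A + c) = c ^ 2 := by rw [← hrc]; linear_combination c ^ 2 * hηL
  generalize (∫ ω, ‖gradient f (Y ω)‖ ^ 2 ∂μ) = D at *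
  have e1 : (A + c) * (η ^ 2 * D) = r * (c ^ 2 * η ^ 2 * D) := by
    rw [← hrc]; ring
  have e2 : 2 * η * (A + c) * (L / 2 * η ^ 2 * σ2) = c ^ 2 * η ^ 2 * σ2 := by
    rw [← h7]; ring
  linarith

end Stochastic

section Parameters

variable {γ : ℕ → ℝ} {r : ℝ}

theorem nesterov_param_sq (hγ : ∀ k, γ (k + 1) = (r⁻¹ + √(r⁻¹ ^ 2 + 4 * γ k ^ 2)) / 2)
    (hr : 0 < r) (k : ℕ) : r * γ (k + 1) ^ 2 = r * γ k ^ 2 + γ (k + 1) := by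
  have h := Real.sq_sqrt (by positivity : 0 ≤ r⁻¹ ^ 2 + 4 * γ k ^ 2)
  have h1 : √(r⁻¹ ^ 2 + 4 * γ k ^ 2) = 2 * γ (k + 1) - r⁻¹ := by rw [hγ k]; ring
  rw [h1] at h
  have h2 : r * r⁻¹ = 1 := mul_inv_cancel₀ hr.ne'
  linear_combination r / 4 * h + γ (k + 1) * h2

theorem nesterov_param_add_le (hγ : ∀ k, γ (k + 1) = (r⁻¹ + √(r⁻¹ ^ 2 + 4 * γ k ^ 2)) / 2)
    (k : ℕ) : γ k + r⁻¹ / 2 ≤ γ (k + 1) := by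
  have h : 2 * γ k ≤ √(r⁻¹ ^ 2 + 4 * γ k ^ 2) :=
    Real.le_sqrt_of_sq_le (by nlinarith [sq_nonneg r⁻¹])
  rw [hγ k]
  linarith

theorem nesterov_param_lower (hγ : ∀ k, γ (k + 1) = (r⁻¹ + √(r⁻¹ ^ 2 + 4 * γ k ^ 2)) / 2)
    (h0 : γ 0 = 0) (hr : 0 < r) (k : ℕ) : (k + 2) / (2 * r) ≤ γ (k + 1) := by
  induction k with
  | zero =>
    rw [hγ 0, h0]
    have : √(r⁻¹ ^ 2 + 4 * 0 ^ 2) = r⁻¹ := by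
      rw [zero_pow two_ne_zero, mul_zero, add_zero, Real.sqrt_sq (inv_nonneg.2 hr.le)]
    rw [this]
    apply le_of_eq
    push_cast
    field_simp
    norm_num
  | succ k ih =>
    have h := nesterov_param_add_le hγ (k + 1)
    have e : ((k + 1 : ℕ) + 2 : ℝ) / (2 * r) = (k + 2) / (2 * r) + r⁻¹ / 2 := by
      push_cast
      field_simp
      ring
    linarith

end Parameters

/-- Convergence of Nesterov-accelerated SGD with an unbiased gradient oracle under
the strong growth condition (Vaswani et al. 2019, Theorem 1): for convex `L`-smooth
`f`, conditionally unbiased gradient estimates with conditional second moment at most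
`ρ ‖∇f(y_k)‖² + σ²`, with `ρ̃ = max{1, ρ}`, step size `η = 1/(ρ̃ L)` and the
accelerated parameter sequences, there is an absolute constant `C` such that
`E[f(x_N)] - f* ≤ C (ρ̃² L R²/N² + N σ²/(L ρ̃²))` for all `N ≥ 1`. -/
theorem stmt1 :
    ∃ C : ℝ, 0 < C ∧
      ∀ (d : ℕ) (Ω : Type) (mΩ : MeasurableSpace Ω) (μ : Measure Ω)
        (_ : IsProbabilityMeasure μ) (ℱ : Filtration ℕ mΩ)
        (f : EuclideanSpace ℝ (Fin d) → ℝ) (L ρ σ2 R ρtil η : ℝ)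
        (xstar : EuclideanSpace ℝ (Fin d)) (fstar : ℝ)
        (x y z g : ℕ → Ω → EuclideanSpace ℝ (Fin d)) (γ a α : ℕ → ℝ),
        0 < L → 0 ≤ ρ → 0 ≤ σ2 →
        ConvexOn ℝ Set.univ f →
        Differentiable ℝ f →
        (∀ u v : EuclideanSpace ℝ (Fin d),
          f v ≤ f u + ⟪gradient f u, v - u⟫ + L / 2 * ‖v - u‖ ^ 2) →
        (∀ u, f xstar ≤ f u) → fstar = f xstar →
        ρtil = max 1 ρ →
        η = 1 / (ρtil * L) →
        γ 0 = 0 →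
        (∀ k, γ (k + 1) = (ρtil⁻¹ + Real.sqrt (ρtil⁻¹ ^ 2 + 4 * γ k ^ 2)) / 2) →
        (∀ k, a (k + 1) = γ k * Real.sqrt (η * ρtil)) →
        (∀ k, α k = γ k * η / (γ k * η + a k ^ 2)) →
        (∀ ω, x 0 ω = z 0 ω) → (∀ ω, y 0 ω = z 0 ω) →
        (∀ k ω, x (k + 1) ω = y k ω - η • g k ω) →
        (∀ k ω, z (k + 1) ω = z k ω - (γ k * η) • g k ω) →
        (∀ k ω, y (k + 1) ω = α (k + 1) • z (k + 1) ω + (1 - α (k + 1)) • x (k + 1) ω) →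
        Adapted ℱ x → Adapted ℱ y → Adapted ℱ z →
        (∀ k, Measurable (g k)) →
        (∀ k, Integrable (g k) μ) →
        (∀ k, Integrable (fun ω => ‖g k ω‖ ^ 2) μ) →
        (∀ k, Integrable (fun ω => f (x k ω)) μ) →
        (∀ k, μ[g k | ℱ k] =ᵐ[μ] fun ω => gradient f (y k ω)) →
        (∀ k, ∀ᵐ ω ∂μ,
          (μ[(fun ω' => ‖g k ω'‖ ^ 2) | ℱ k]) ω ≤ ρ * ‖gradient f (y k ω)‖ ^ 2 + σ2) →
        (∀ ω, ‖z 0 ω - xstar‖ = R) →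
        ∀ N : ℕ, 1 ≤ N →
          (∫ ω, f (x N ω) ∂μ) - fstar ≤
            C * (ρtil ^ 2 * L * R ^ 2 / N ^ 2 + N * σ2 / (L * ρtil ^ 2)) := by
  refine ⟨2, two_pos, ?_⟩
  intro d Ω mΩ μ _ ℱ f L ρ σ2 R r η p fstar x y z g γ a α hL hρ hσ hconv hd hs hp hfs hr hη hγ0 hγ
    ha hα hx0 hy0 hx hz hy _ _ hzad hgm _ hg2 _ hunb hgrow hR N hN
  have hr1 : 1 ≤ r := hr ▸ le_max_left _ _
  have hρr : ρ ≤ r := hr ▸ le_max_right _ _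
  have hr0 : 0 < r := one_pos.trans_le hr1
  have hη0 : 0 < η := hη ▸ by positivity
  have hηL : L * η * r = 1 := by rw [hη]; field_simp
  have hγn : ∀ k, 0 ≤ γ k := by
    intro k
    cases k with
    | zero => exact hγ0.ge
    | succ k => exact le_trans (by positivity) (nesterov_param_lower hγ hγ0 hr0 k)
  have hg : ∀ k, MemLp (g k) 2 μ := fun k =>
    (memLp_two_iff_integrable_sq_norm (hgm k).aestronglyMeasurable).2 (hg2 k)
  have hzm : ∀ k, StronglyMeasurable[ℱ k] (z k) := fun k => (hzad k).stronglyMeasurable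
  have hz0 : MemLp (z 0) 2 μ := by
    refine MemLp.of_bound ((hzm 0).mono (ℱ.le 0)).aestronglyMeasurable (R + ‖p‖)
      (.of_forall fun ω => ?_)
    have h := norm_add_le (z 0 ω - p) p
    rwa [sub_add_cancel, hR ω] at h
  have hmem : ∀ k, MemLp (x k) 2 μ ∧ MemLp (y k) 2 μ ∧ MemLp (z k) 2 μ := by
    intro k
    induction k with
    | zero => exact ⟨(funext hx0 : x 0 = z 0) ▸ hz0, (funext hy0 : y 0 = z 0) ▸ hz0, hz0⟩
    | succ k ih =>
      have h1 : MemLp (x (k + 1)) 2 μ :=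
        (funext (hx k) : x (k + 1) = _) ▸ ih.2.1.sub ((hg k).const_smul η)
      have h2 : MemLp (z (k + 1)) 2 μ :=
        (funext (hz k) : z (k + 1) = _) ▸ ih.2.2.sub ((hg k).const_smul (γ k * η))
      exact ⟨h1, (funext (hy k) : y (k + 1) = _) ▸
        (h2.const_smul (α (k + 1))).add (h1.const_smul (1 - α (k + 1))), h2⟩
  have hcomb : ∀ k ω, (r * γ k ^ 2 + γ (k + 1)) • y (k + 1) ω
      = γ (k + 1) • z (k + 1) ω + (r * γ k ^ 2) • x (k + 1) ω := by
    intro k ω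
    have hpos : 0 < γ (k + 1) :=
      lt_of_lt_of_le (by positivity) (nesterov_param_lower hγ hγ0 hr0 k)
    have hA : (r * γ k ^ 2 + γ (k + 1)) * α (k + 1) = γ (k + 1) := by
      have hne : r * γ k ^ 2 + γ (k + 1) ≠ 0 := by positivity
      rw [hα, ha, mul_pow, Real.sq_sqrt (by positivity)]
      have e : γ (k + 1) * η + γ k ^ 2 * (η * r) = η * (r * γ k ^ 2 + γ (k + 1)) := by ring
      rw [e]
      field_simp
    rw [hy, smul_add, smul_smul, smul_smul, mul_sub, hA, mul_one, add_sub_cancel_right]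
  have hlyap : ∀ k : ℕ, 2 * η * (r * γ k ^ 2) * (∫ ω, f (x (k + 1) ω) ∂μ - f p)
      + ∫ ω, ‖z (k + 1) ω - p‖ ^ 2 ∂μ ≤ R ^ 2 + 2 * η ^ 2 * σ2 * (k * γ k ^ 2) := by
    intro k
    induction k with
    | zero => simp [hz 0, hγ0, hR]
    | succ k ih =>
      have h := integral_lyapunov_step_le (ℱ.le (k + 1)) hL hconv hd hs hp (hmem (k + 1)).1
        (hmem (k + 1)).2.1 (hzm (k + 1)) (hmem (k + 1)).2.2 (hg (k + 1)) (hunb (k + 1))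
        (hgrow (k + 1)) hρr hη0.le hηL (hγn (k + 1))
        (by positivity : 0 ≤ r * γ k ^ 2) (nesterov_param_sq hγ hr0 k) (hcomb k)
      simp only [← hx, ← hz, ← nesterov_param_sq hγ hr0 k] at h
      have hmono : γ k ≤ γ (k + 1) := by
        have := nesterov_param_add_le hγ k
        have : 0 < r⁻¹ := inv_pos.2 hr0
        linarith
      have hsq : γ k ^ 2 ≤ γ (k + 1) ^ 2 := pow_le_pow_left₀ (hγn k) hmono 2
      have h2 := mul_le_mul_of_nonneg_left hsq (by positivity : 0 ≤ 2 * η ^ 2 * σ2 * k)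
      push_cast
      linarith
  subst hfs
  obtain ⟨k, rfl⟩ : ∃ k, N = k + 1 := ⟨N - 1, by omega⟩
  rcases k with _ | k
  · have h := integral_gradient_step_le (ℱ.le 0) hL hd hs hp (hmem 0).2.1 (hg 0) (hunb 0) (hgrow 0)
      hη0.le ((mul_le_mul_of_nonneg_left hρr (by positivity)).trans_eq hηL)
    simp only [← hx] at h
    have hD0 : 0 ≤ η / 2 * ∫ ω, ‖gradient f (y 0 ω)‖ ^ 2 ∂μ :=
      mul_nonneg (by positivity) (integral_nonneg fun ω => sq_nonneg _)
    have hy1 : ∫ ω, f (y 0 ω) ∂μ ≤ f p + L / 2 * R ^ 2 := by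
      have := integral_mono (μ := μ) (integrable_comp_of_smooth hL hd hs hp (hmem 0).2.1)
        (integrable_const (f p + L / 2 * R ^ 2)) fun ω => by
          simpa [hy0, hR] using le_add_norm_sub_sq_of_smooth hL hs hp (y 0 ω)
      simpa using this
    have e : L / 2 * η ^ 2 * σ2 = σ2 / (L * r ^ 2) / 2 := by rw [hη]; field_simp
    have h1 : 0 ≤ σ2 / (L * r ^ 2) := by positivity
    have h2 : L * R ^ 2 ≤ r ^ 2 * L * R ^ 2 := by
      have : 1 ≤ r ^ 2 := one_le_pow₀ hr1
      nlinarith [mul_nonneg hL.le (sq_nonneg R)]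
    have h3 : 0 ≤ L * R ^ 2 := by positivity
    simp only [zero_add, Nat.cast_one, one_pow, div_one, one_mul]
    linarith
  · have hl := hlyap (k + 1)
    have hZ : 0 ≤ ∫ ω, ‖z (k + 1 + 1) ω - p‖ ^ 2 ∂μ := integral_nonneg fun ω => sq_nonneg _
    have hlow := nesterov_param_lower hγ hγ0 hr0 k
    have hγpos : 0 < γ (k + 1) := lt_of_lt_of_le (by positivity) hlow
    have hsq : ((k + 2 : ℝ) / (2 * r)) ^ 2 ≤ γ (k + 1) ^ 2 :=
      pow_le_pow_left₀ (by positivity) hlow 2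
    have hmain : ∫ ω, f (x (k + 1 + 1) ω) ∂μ - f p
        ≤ L * R ^ 2 / (2 * γ (k + 1) ^ 2) + (k + 1) * σ2 / (L * r ^ 2) := by
      have hpos : 0 < 2 * η * (r * γ (k + 1) ^ 2) := by positivity
      refine le_of_mul_le_mul_left ?_ hpos
      have e : 2 * η * (r * γ (k + 1) ^ 2) *
          (L * R ^ 2 / (2 * γ (k + 1) ^ 2) + (k + 1) * σ2 / (L * r ^ 2))
          = R ^ 2 + 2 * η ^ 2 * σ2 * ((k + 1) * γ (k + 1) ^ 2) := by
        rw [hη]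
        field_simp
      push_cast at hl
      linarith
    have h1 : L * R ^ 2 / (2 * γ (k + 1) ^ 2) ≤ 2 * (r ^ 2 * L * R ^ 2 / (k + 2) ^ 2) := by
      calc L * R ^ 2 / (2 * γ (k + 1) ^ 2)
          ≤ L * R ^ 2 / (2 * ((k + 2 : ℝ) / (2 * r)) ^ 2) := by gcongr
        _ = 2 * (r ^ 2 * L * R ^ 2 / (k + 2) ^ 2) := by field_simp
    have h2 : (k + 1) * σ2 / (L * r ^ 2) ≤ 2 * ((k + 2) * σ2 / (L * r ^ 2)) := by
      rw [← mul_div_assoc]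
      refine div_le_div_of_nonneg_right ?_ (by positivity)
      nlinarith [mul_nonneg (Nat.cast_nonneg (α := ℝ) k) hσ]
    have e : ((k + 1 + 1 : ℕ) : ℝ) = k + 2 := by push_cast; ring
    rw [e]
    linarith
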